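/- Suppose each h_i ∈ H (i = 1,…,n) is continuous and convex on [0,1]. Let 𝒳 = L^− (nonpositive bounded random variables) and let X ∈ 𝒳 be such that there exists a random variable U uniform on [0,1] independent of X. Then □_{i=1}^n ρ_{h_i}(X) = ⊟_{i=1}^n ρ_{h_i}(X) = ρ_g(X), where g(x) = (◊_{i=1}^n h̃_i)(1) − (◊_{i=1}^n h̃_i)(1−x) for x ∈ [0,1] (equivalently, the dual of g is the sup-convolution ◊_{i=1}^n h̃_i of the duals h̃_i(t) = 1 − h_i(1−t)), and ρ_g(X) = ∫_{-∞}^0 ( g(P(X ≥ x)) − g(1) ) dx. -/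

import Mathlib

open MeasureTheory ProbabilityTheory Set

noncomputable section

variable {Ω : Type*} [MeasurableSpace Ω]

/-- An atomless measure: every set of positive measure has a measurable subset of
strictly smaller positive measure. -/
def Atomless (P : Measure Ω) : Prop :=
  ∀ A : Set Ω, MeasurableSet A → 0 < P A →
    ∃ B, B ⊆ A ∧ MeasurableSet B ∧ 0 < P B ∧ P B < P A

/-- Membership in the class `H` of distortion functions: increasing on `[0,1]`,
`h 0 = 0` and `h 1 = 1`. -/
def MemH (h : ℝ → ℝ) : Prop :=
  MonotoneOn h (Icc 0 1) ∧ h 0 = 0 ∧ h 1 = 1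

/-- Two random variables are counter-monotonic. -/
def CounterMonotone (P : Measure Ω) (X Y : Ω → ℝ) : Prop :=
  ∀ᵐ p ∂(P.prod P), (X p.1 - X p.2) * (Y p.1 - Y p.2) ≤ 0

/-- Two random variables are comonotonic. -/
def Comonotone (P : Measure Ω) (X Y : Ω → ℝ) : Prop :=
  ∀ᵐ p ∂(P.prod P), 0 ≤ (X p.1 - X p.2) * (Y p.1 - Y p.2)

/-- A random vector is pairwise counter-monotonic. -/
def PairwiseCtr (P : Measure Ω) {n : ℕ} (Xs : Fin n → Ω → ℝ) : Prop :=
  ∀ i j, i ≠ j → CounterMonotone P (Xs i) (Xs j)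

/-- A random vector is (pairwise) comonotonic. -/
def PairwiseCom (P : Measure Ω) {n : ℕ} (Xs : Fin n → Ω → ℝ) : Prop :=
  ∀ i j, i ≠ j → Comonotone P (Xs i) (Xs j)

/-- Nonpositive bounded measurable random variables (`L^−`). -/
def MemLneg (X : Ω → ℝ) : Prop :=
  Measurable X ∧ (∀ ω, X ω ≤ 0) ∧ ∃ M : ℝ, ∀ ω, -M ≤ X ω

/-- The distortion riskmetric of a nonpositive random variable:
`ρ_g(X) = ∫_{-∞}^0 (g(P(X ≥ x)) − g(1)) dx`. -/
def distortionNeg (P : Measure Ω) (g : ℝ → ℝ) (X : Ω → ℝ) : ℝ :=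
  ∫ x in Iio (0:ℝ), (g ((P {ω | x ≤ X ω}).toReal) - g 1)

/-- `Xs` is an allocation of `X` within `L^−`. -/
def IsAllocNeg (P : Measure Ω) {n : ℕ} (X : Ω → ℝ) (Xs : Fin n → Ω → ℝ) : Prop :=
  (∀ i, MemLneg (Xs i)) ∧ (∀ᵐ ω ∂P, ∑ i, Xs i ω = X ω)

/-- The inf-convolution `□_{i=1}^n ρ_{h_i}(X)` over allocations in `L^−`. -/
def infConvNeg (P : Measure Ω) {n : ℕ} (h : Fin n → ℝ → ℝ) (X : Ω → ℝ) : EReal :=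
  sInf {y : EReal | ∃ Xs : Fin n → Ω → ℝ, IsAllocNeg P X Xs ∧
    y = ((∑ i, distortionNeg P (h i) (Xs i) : ℝ) : EReal)}

/-- The counter-monotonic inf-convolution `⊟_{i=1}^n ρ_{h_i}(X)` over allocations in `L^−`. -/
def ctrInfConvNeg (P : Measure Ω) {n : ℕ} (h : Fin n → ℝ → ℝ) (X : Ω → ℝ) : EReal :=
  sInf {y : EReal | ∃ Xs : Fin n → Ω → ℝ, IsAllocNeg P X Xs ∧ PairwiseCtr P Xs ∧
    y = ((∑ i, distortionNeg P (h i) (Xs i) : ℝ) : EReal)}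

/-- The sup-convolution of functions `l_1, …, l_n` on `[0,1]`:
`(◊ l_i)(x) = sup { Σ l_i(x_i) : x_i ∈ [0,1], Σ x_i = x }`. -/
def funSupConv {n : ℕ} (l : Fin n → ℝ → ℝ) (x : ℝ) : ℝ :=
  sSup {y : ℝ | ∃ t : Fin n → ℝ, (∀ i, t i ∈ Icc (0:ℝ) 1) ∧ (∑ i, t i) = x ∧
    y = ∑ i, l i (t i)}

lemma ConcaveOn.increment_le {l : ℝ → ℝ} (hl : ConcaveOn ℝ (Icc 0 1) l) {x y a d : ℝ}
    (hx : 0 ≤ x) (hxy : x ≤ y) (ha : 0 ≤ a) (had : a ≤ d) (hd : 0 < d) (hyd : y + d ≤ 1) :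
    (l (y + d) - l y) / d * a ≤ l (x + a) - l x := by
  rcases ha.eq_or_lt with rfl | ha
  · simp
  have key : ∀ {u v w : ℝ}, u ∈ Icc (0:ℝ) 1 → v ∈ Icc (0:ℝ) 1 → w ∈ Icc (0:ℝ) 1 → v ≠ u → w ≠ u →
      v ≤ w → (l w - l u) / (w - u) ≤ (l v - l u) / (v - u) := by
    intro u v w hu hv hw h1 h2 h3
    have := hl.neg.secant_mono hu hv hw h1 h2 h3
    simp only [Pi.neg_apply] at this
    have e1 : (-l v - -l u) / (v - u) = -((l v - l u) / (v - u)) := by ring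
    have e2 : (-l w - -l u) / (w - u) = -((l w - l u) / (w - u)) := by ring
    rw [e1, e2] at this
    linarith
  have mx : x ∈ Icc (0:ℝ) 1 := ⟨hx, by linarith⟩
  have my : y ∈ Icc (0:ℝ) 1 := ⟨by linarith, by linarith⟩
  have mxa : x + a ∈ Icc (0:ℝ) 1 := ⟨by linarith, by linarith⟩
  have myd : y + d ∈ Icc (0:ℝ) 1 := ⟨by linarith, by linarith⟩
  have h1 := key mx mxa myd (by linarith) (by linarith) (by linarith)
  have h2 := key myd mx my (by linarith) (by linarith) (by linarith)
  have e3 : (l y - l (y + d)) / (y - (y + d)) = (l (y + d) - l y) / d := by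
    rw [← neg_div_neg_eq]; congr 1 <;> ring
  have e4 : (l x - l (y + d)) / (x - (y + d)) = (l (y + d) - l x) / (y + d - x) := by
    rw [← neg_div_neg_eq]; congr 1 <;> ring
  have e5 : x + a - x = a := by ring
  rw [e3, e4] at h2
  rw [e5] at h1
  exact (le_div_iff₀ ha).1 (h2.trans h1)

lemma ConcaveOn.sub_le_sub_of_le {l : ℝ → ℝ} (hl : ConcaveOn ℝ (Icc 0 1) l) {x y d : ℝ}
    (hx : 0 ≤ x) (hxy : x ≤ y) (hd : 0 < d) (hyd : y + d ≤ 1) :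
    l (y + d) - l y ≤ l (x + d) - l x := by
  simpa [hd.ne'] using hl.increment_le hx hxy hd.le le_rfl hd hyd

/-- `t` is an optimal splitting of `x` for the sup-convolution of `l`. -/
def IsOptSplit {n : ℕ} (l : Fin n → ℝ → ℝ) (x : ℝ) (t : Fin n → ℝ) : Prop :=
  (∀ i, t i ∈ Icc (0:ℝ) 1) ∧ ∑ i, t i = x ∧
    ∀ s : Fin n → ℝ, (∀ i, s i ∈ Icc (0:ℝ) 1) → ∑ i, s i = x → ∑ i, l i (s i) ≤ ∑ i, l i (t i)

lemma IsOptSplit.funSupConv_eq {n : ℕ} {l : Fin n → ℝ → ℝ} {x : ℝ} {t : Fin n → ℝ}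
    (ht : IsOptSplit l x t) : funSupConv l x = ∑ i, l i (t i) := by
  refine IsGreatest.csSup_eq ⟨⟨t, ht.1, ht.2.1, rfl⟩, ?_⟩
  rintro y ⟨s, hs, hsx, rfl⟩
  exact ht.2.2 s hs hsx

lemma isCompact_splits (n : ℕ) (x : ℝ) :
    IsCompact {t : Fin n → ℝ | (∀ i, t i ∈ Icc (0:ℝ) 1) ∧ ∑ i, t i = x} := by
  have h1 : IsCompact (Set.pi univ fun _ : Fin n => Icc (0:ℝ) 1) :=
    isCompact_univ_pi fun _ => isCompact_Icc
  have h2 : IsClosed {t : Fin n → ℝ | ∑ i, t i = x} :=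
    isClosed_eq (by fun_prop) continuous_const
  convert h1.inter_right h2 using 1
  ext t
  simp only [mem_ofPred_eq, mem_inter_iff, mem_univ_pi]

lemma continuousOn_sum_splits {n : ℕ} {l : Fin n → ℝ → ℝ}
    (hl : ∀ i, ContinuousOn (l i) (Icc 0 1)) (x : ℝ) :
    ContinuousOn (fun t : Fin n → ℝ => ∑ i, l i (t i))
      {t : Fin n → ℝ | (∀ i, t i ∈ Icc (0:ℝ) 1) ∧ ∑ i, t i = x} :=
  continuousOn_finsetSum _ fun i _ =>
    (hl i).comp (continuous_apply i).continuousOn fun _ ht => ht.1 i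

lemma exists_isOptSplit {n : ℕ} (hn : 0 < n) {l : Fin n → ℝ → ℝ}
    (hl : ∀ i, ContinuousOn (l i) (Icc 0 1)) {x : ℝ} (hx : x ∈ Icc (0:ℝ) 1) :
    ∃ t, IsOptSplit l x t := by
  obtain ⟨t, ht, hmax⟩ := (isCompact_splits n x).exists_isMaxOn
    ⟨Pi.single ⟨0, hn⟩ x, fun i => by
      by_cases h : i = ⟨0, hn⟩
      · subst h; simpa using hx
      · simp [h], by simp⟩ (continuousOn_sum_splits hl x)
  exact ⟨t, ht.1, ht.2, fun s hs hsx => hmax ⟨hs, hsx⟩⟩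

lemma sum_transfer {n : ℕ} (l : Fin n → ℝ → ℝ) (t : Fin n → ℝ) {i j : Fin n} (hij : i ≠ j)
    (a b : ℝ) :
    ∑ k, l k (Function.update (Function.update t i a) j b k) =
      ∑ k, l k (t k) + (l i a - l i (t i)) + (l j b - l j (t j)) := by
  have : ∀ k, l k (Function.update (Function.update t i a) j b k) =
      l k (t k) + (if k = i then l i a - l i (t i) else 0) +
        (if k = j then l j b - l j (t j) else 0) := by
    intro k
    by_cases hkj : k = j
    · subst hkj; simp [hij.symm]
    · by_cases hki : k = i
      · subst hki; simp [hij]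
      · simp [hkj, hki]
  simp [this, Finset.sum_add_distrib]

/-- Optimal splittings of concave functions can be chosen decreasing as the total decreases. -/
lemma IsOptSplit.exists_le {n : ℕ} (hn : 0 < n) {l : Fin n → ℝ → ℝ}
    (hcont : ∀ i, ContinuousOn (l i) (Icc 0 1)) (hconc : ∀ i, ConcaveOn ℝ (Icc 0 1) (l i))
    {x y : ℝ} {t : Fin n → ℝ} (ht : IsOptSplit l x t) (hy : 0 ≤ y) (hyx : y ≤ x) (hx : x ≤ 1) :
    ∃ s, IsOptSplit l y s ∧ ∀ i, s i ≤ t i := by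
  obtain ⟨s₀, hs₀⟩ := exists_isOptSplit hn hcont ⟨hy, hyx.trans hx⟩
  set S := {s : Fin n → ℝ | (∀ i, s i ∈ Icc (0:ℝ) 1) ∧ ∑ i, s i = y}
  have hcompact : IsCompact (S ∩ (fun s : Fin n → ℝ => ∑ i, l i (s i)) ⁻¹'
      Ici (∑ i, l i (s₀ i))) := by
    refine (isCompact_splits n y).of_isClosed_subset ?_ inter_subset_left
    exact (continuousOn_sum_splits hcont y).preimage_isClosed_of_isClosed
      (isCompact_splits n y).isClosed isClosed_Ici
  obtain ⟨s, ⟨⟨hs1, hs2⟩, hs3⟩, hmin⟩ := hcompact.exists_isMinOn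
    (f := fun s : Fin n → ℝ => ∑ i, max (s i - t i) 0)
    ⟨s₀, ⟨hs₀.1, hs₀.2.1⟩, by simp⟩ (by fun_prop)
  have hsopt : IsOptSplit l y s := ⟨hs1, hs2, fun r hr hry => (hs₀.2.2 r hr hry).trans hs3⟩
  refine ⟨s, hsopt, ?_⟩
  by_contra! hcon
  obtain ⟨i, hi⟩ := hcon
  obtain ⟨j, hj⟩ : ∃ j, s j < t j := by
    by_contra! hle
    have : ∑ k, t k < ∑ k, s k := Finset.sum_lt_sum (fun k _ => hle k) ⟨i, Finset.mem_univ _, hi⟩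
    rw [hs2, ht.2.1] at this
    linarith
  have hij : i ≠ j := by rintro rfl; linarith
  obtain ⟨d, hd, hdi, hdj⟩ : ∃ d, 0 < d ∧ d ≤ s i - t i ∧ d ≤ t j - s j :=
    ⟨min (s i - t i) (t j - s j), lt_min (by linarith) (by linarith), min_le_left _ _,
      min_le_right _ _⟩
  have bsi := hs1 i
  have bsj := hs1 j
  have bti := ht.1 i
  have btj := ht.1 j
  simp only [mem_Icc] at bsi bsj bti btj
  have mem_update : ∀ (r : Fin n → ℝ) (a b : ℝ), (∀ k, r k ∈ Icc (0:ℝ) 1) → a ∈ Icc (0:ℝ) 1 →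
      b ∈ Icc (0:ℝ) 1 → ∀ k, Function.update (Function.update r i a) j b k ∈ Icc (0:ℝ) 1 := by
    intro r a b hr ha hb k
    by_cases hkj : k = j
    · subst hkj; simpa using hb
    · by_cases hki : k = i
      · subst hki; simpa [hij] using ha
      · simpa [hkj, hki] using hr k
  have h1 := ht.2.2 (Function.update (Function.update t i (t i + d)) j (t j - d))
    (mem_update _ _ _ ht.1 ⟨by linarith, by linarith⟩ ⟨by linarith, by linarith⟩)
    (by rw [sum_transfer (fun _ u => u) t hij, ht.2.1]; ring)
  rw [sum_transfer l t hij] at h1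
  have h2 := (hconc i).sub_le_sub_of_le (x := t i) (y := s i - d) bti.1 (by linarith) hd
    (by linarith)
  have h3 := (hconc j).sub_le_sub_of_le (x := s j) (y := t j - d) bsj.1 (by linarith) hd
    (by linarith)
  simp only [sub_add_cancel] at h2 h3
  have h4 : ∑ k, max (s k - t k) 0 ≤
      ∑ k, max (Function.update (Function.update s i (s i - d)) j (s j + d) k - t k) 0 := by
    refine hmin ⟨⟨mem_update _ _ _ hs1 ⟨by linarith, by linarith⟩ ⟨by linarith, by linarith⟩, ?_⟩,
      ?_⟩
    · rw [sum_transfer (fun _ u => u) s hij, hs2]; ring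
    · simp only [mem_preimage, mem_Ici] at hs3 ⊢
      rw [sum_transfer l s hij]
      linarith
  rw [sum_transfer (fun k u => max (u - t k) 0) s hij] at h4
  rw [max_eq_left (by linarith : 0 ≤ s i - d - t i), max_eq_left (by linarith : 0 ≤ s i - t i),
    max_eq_right (by linarith : s j + d - t j ≤ 0), max_eq_right (by linarith : s j - t j ≤ 0)] at h4
  linarith

/-- The integral of the distorted tail probabilities of a nonnegative random variable. -/
def tailIntegral (P : Measure Ω) (φ : ℝ → ℝ) (Y : Ω → ℝ) : ℝ :=
  ∫ s in Ioi (0:ℝ), φ (P.real {ω | s < Y ω})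

lemma measureReal_mem_Icc (P : Measure Ω) [IsProbabilityMeasure P] (A : Set Ω) :
    P.real A ∈ Icc (0:ℝ) 1 :=
  ⟨measureReal_nonneg, measureReal_le_one⟩

lemma distortionNeg_eq_neg_tailIntegral (P : Measure Ω) [IsProbabilityMeasure P] {g φ : ℝ → ℝ}
    (hφ : ∀ p ∈ Icc (0:ℝ) 1, g (1 - p) - g 1 = -φ p) {X : Ω → ℝ} (hX : Measurable X) :
    distortionNeg P g X = -tailIntegral P φ (fun ω => -X ω) := by
  have h1 := integral_comp_neg_Ioi (0:ℝ) fun x => g ((P {ω | x ≤ X ω}).toReal) - g 1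
  rw [neg_zero, integral_Iic_eq_integral_Iio] at h1
  rw [distortionNeg, ← h1, tailIntegral, ← integral_neg]
  congr 1
  ext s
  have hmeas : MeasurableSet {ω | s < -X ω} := measurableSet_lt measurable_const hX.neg
  rw [← hφ _ (measureReal_mem_Icc P _), ← probReal_compl_eq_one_sub hmeas]
  have hset : {ω | -s ≤ X ω} = {ω | s < -X ω}ᶜ := by
    ext ω
    simp only [mem_ofPred_eq, mem_compl_iff, not_lt]
    constructor <;> intro h <;> linarith
  rw [hset]
  rfl

lemma antitone_comp_tail (P : Measure Ω) [IsProbabilityMeasure P] {φ : ℝ → ℝ}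
    (hφ : MonotoneOn φ (Icc 0 1)) (Y : Ω → ℝ) :
    Antitone fun s => φ (P.real {ω | s < Y ω}) := fun _ _ hst =>
  hφ (measureReal_mem_Icc P _) (measureReal_mem_Icc P _)
    (measureReal_mono fun _ hω => lt_of_le_of_lt hst hω)

lemma tailIntegral_eq_mul_intervalIntegral (P : Measure Ω) [IsProbabilityMeasure P] {φ : ℝ → ℝ}
    (hφ0 : φ 0 = 0) {Y : Ω → ℝ} {ε : ℝ} (hε : 0 < ε) {K : ℕ} (hY : ∀ ω, Y ω ≤ ε * K) :
    tailIntegral P φ Y = ε * ∫ x in (0:ℝ)..(0 + K), φ (P.real {ω | ε * x < Y ω}) := by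
  rw [intervalIntegral.mul_integral_comp_mul_left (f := fun s => φ (P.real {ω | s < Y ω})),
    mul_zero, zero_add, intervalIntegral.integral_of_le (by positivity), tailIntegral]
  refine setIntegral_eq_of_subset_of_forall_sdiff_eq_zero measurableSet_Ioi
    Ioc_subset_Ioi_self ?_
  rintro s ⟨hs0, hs⟩
  have hs' : ε * K < s := by
    by_contra! h
    exact hs ⟨hs0, h⟩
  have : {ω | s < Y ω} = ∅ := by
    ext ω
    simpa using (hY ω).trans hs'.le
  simp [this, hφ0]

lemma le_tailIntegral (P : Measure Ω) [IsProbabilityMeasure P] {φ : ℝ → ℝ}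
    (hφ : MonotoneOn φ (Icc 0 1)) (hφ0 : φ 0 = 0) {Y : Ω → ℝ} {ε : ℝ} (hε : 0 < ε) {K : ℕ}
    (hY : ∀ ω, Y ω ≤ ε * K) :
    ε * ∑ m ∈ Finset.range K, φ (P.real {ω | ε * (m + 1 : ℕ) < Y ω}) ≤ tailIntegral P φ Y := by
  rw [tailIntegral_eq_mul_intervalIntegral P hφ0 hε hY]
  have := ((antitone_comp_tail P hφ Y).comp_monotone
    (monotone_mul_left_of_nonneg hε.le)).antitoneOn (Icc (0:ℝ) (0 + K)) |>.sum_le_integral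
  simp only [Function.comp_apply, zero_add] at this ⊢
  gcongr

lemma tailIntegral_le (P : Measure Ω) [IsProbabilityMeasure P] {φ : ℝ → ℝ}
    (hφ : MonotoneOn φ (Icc 0 1)) (hφ0 : φ 0 = 0) {Y : Ω → ℝ} {ε : ℝ} (hε : 0 < ε) {K : ℕ}
    (hY : ∀ ω, Y ω ≤ ε * K) :
    tailIntegral P φ Y ≤
      ε * φ 1 + ε * ∑ m ∈ Finset.range K, φ (P.real {ω | ε * (m + 1 : ℕ) < Y ω}) := by
  rw [tailIntegral_eq_mul_intervalIntegral P hφ0 hε hY, ← mul_add]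
  have h1 := ((antitone_comp_tail P hφ Y).comp_monotone
    (monotone_mul_left_of_nonneg hε.le)).antitoneOn (Icc (0:ℝ) (0 + K)) |>.integral_le_sum
  simp only [Function.comp_apply, zero_add] at h1 ⊢
  gcongr
  refine h1.trans ?_
  have h2 := Finset.sum_range_succ (fun m : ℕ => φ (P.real {ω | ε * m < Y ω})) K
  rw [Finset.sum_range_succ'] at h2
  have nonneg : ∀ A, 0 ≤ φ (P.real A) := fun A =>
    hφ0 ▸ hφ (by simp) (measureReal_mem_Icc P A) measureReal_nonneg
  have h3 : φ (P.real {ω | ε * (0 : ℕ) < Y ω}) ≤ φ 1 :=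
    hφ (measureReal_mem_Icc P _) (by simp) measureReal_le_one
  linarith [nonneg {ω | ε * K < Y ω}]

lemma measureReal_inter_level (P : Measure Ω) [IsProbabilityMeasure P] {J : Ω → ℕ}
    (hJ : Measurable J) {A : Set Ω} (hA : MeasurableSet A) (m : ℕ) :
    P.real (A ∩ {ω | m ≤ J ω}) =
      P.real (A ∩ {ω | m + 1 ≤ J ω}) + P.real (A ∩ {ω | J ω = m}) := by
  have meq : MeasurableSet {ω | J ω = m} := hJ (measurableSet_singleton m)
  rw [← measureReal_union (Set.disjoint_left.2 fun ω h1 h2 => ?_)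
    (hA.inter meq), ← inter_union_distrib_left]
  · congr 2
    ext ω
    simp only [mem_ofPred_eq, mem_union]
    omega
  · simp only [mem_inter_iff, mem_ofPred_eq] at h1 h2
    omega

/-- A concave distortion dominates an additive set function that agrees with it along the upper
level sets of an integer-valued random variable. -/
lemma exists_dominated_density (P : Measure Ω) [IsProbabilityMeasure P] {l : ℝ → ℝ}
    (hl : ConcaveOn ℝ (Icc 0 1) l) (hl0 : l 0 = 0) {N : Ω → ℕ} (hN : Measurable N) {K : ℕ}
    (hNK : ∀ ω, N ω ≤ K) :
    ∃ c : ℕ → ℝ, Integrable (fun ω => c (N ω)) P ∧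
      (∀ m, ∫ ω in {ω | m ≤ N ω}, c (N ω) ∂P = l (P.real {ω | m ≤ N ω})) ∧
      ∀ A, MeasurableSet A → ∫ ω in A, c (N ω) ∂P ≤ l (P.real A) := by
  set p : ℕ → ℝ := fun m => P.real {ω | m ≤ N ω} with hp
  set c : ℕ → ℝ := fun m => (l (p m) - l (p (m + 1))) / (p m - p (m + 1)) with hc
  have meq : ∀ m, MeasurableSet {ω | N ω = m} := fun m => hN (measurableSet_singleton m)
  have hint : Integrable (fun ω => c (N ω)) P := by
    refine Integrable.of_bound
      (measurable_from_nat (f := c) |>.comp hN).aestronglyMeasurable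
      (∑ j ∈ Finset.range (K + 1), ‖c j‖) (Filter.Eventually.of_forall fun ω => ?_)
    exact Finset.single_le_sum (f := fun j => ‖c j‖) (fun j _ => norm_nonneg _)
      (Finset.mem_range.2 (Nat.lt_succ_of_le (hNK ω)))
  have split : ∀ (A : Set Ω) (m : ℕ), A ∩ {ω | m ≤ N ω} =
      (A ∩ {ω | m + 1 ≤ N ω}) ∪ (A ∩ {ω | N ω = m}) := by
    intro A m
    rw [← inter_union_distrib_left]
    congr 1
    ext ω
    simp only [mem_ofPred_eq, mem_union]
    omega
  have disj : ∀ (A : Set Ω) (m : ℕ),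
      Disjoint (A ∩ {ω | m + 1 ≤ N ω}) (A ∩ {ω | N ω = m}) := by
    intro A m
    refine Disjoint.mono inter_subset_right inter_subset_right ?_
    rw [Set.disjoint_left]
    intro ω h1 h2
    simp only [mem_ofPred_eq] at h1 h2
    omega
  have int_split : ∀ A, MeasurableSet A → ∀ m, ∫ ω in A ∩ {ω | m ≤ N ω}, c (N ω) ∂P =
      ∫ ω in A ∩ {ω | m + 1 ≤ N ω}, c (N ω) ∂P + c m * P.real (A ∩ {ω | N ω = m}) := by
    intro A hA m
    rw [split, setIntegral_union (disj A m) (hA.inter (meq m)) hint.integrableOn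
      hint.integrableOn, setIntegral_congr_fun (g := fun _ => c m) (hA.inter (meq m))
      (fun ω hω => by simp only [mem_inter_iff, mem_ofPred_eq] at hω; simp [hω.2]),
      setIntegral_const, smul_eq_mul, mul_comm (c m)]
  have p_split : ∀ m, p m = p (m + 1) + P.real {ω | N ω = m} := fun m => by
    simpa only [univ_inter] using measureReal_inter_level P hN MeasurableSet.univ m
  have hempty : {ω | K + 1 ≤ N ω} = ∅ := by
    ext ω
    simpa using hNK ω
  have upper : ∀ A, MeasurableSet A → ∀ m ≤ K + 1,
      ∫ ω in A ∩ {ω | m ≤ N ω}, c (N ω) ∂P ≤ l (P.real (A ∩ {ω | m ≤ N ω})) := by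
    intro A hA m hm
    induction hm using Nat.decreasingInduction with
    | self => rw [hempty]; simp [hl0]
    | of_succ m hm ih =>
      rw [int_split A hA, measureReal_inter_level P hN hA]
      have ha : P.real (A ∩ {ω | N ω = m}) ≤ P.real {ω | N ω = m} :=
        measureReal_mono inter_subset_right
      rcases (measureReal_nonneg (μ := P) (s := {ω | N ω = m})).eq_or_lt with h0 | hpos
      · have : P.real (A ∩ {ω | N ω = m}) = 0 := le_antisymm (h0 ▸ ha) measureReal_nonneg
        simpa [this] using ih
      · have := hl.increment_le (x := P.real (A ∩ {ω | m + 1 ≤ N ω})) (y := p (m + 1))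
          measureReal_nonneg (measureReal_mono inter_subset_right) measureReal_nonneg ha hpos
          (by rw [← p_split]; exact measureReal_le_one)
        have hcm : c m = (l (p (m + 1) + P.real {ω | N ω = m}) - l (p (m + 1))) /
            P.real {ω | N ω = m} := by
          rw [← p_split, show P.real {ω | N ω = m} = p m - p (m + 1) by linarith [p_split m]]
        rw [hcm]
        linarith
  have exact_level : ∀ m ≤ K + 1, ∫ ω in {ω | m ≤ N ω}, c (N ω) ∂P = l (p m) := by
    intro m hm
    induction hm using Nat.decreasingInduction with
    | self => simp only [hp]; rw [hempty]; simp [hl0]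
    | of_succ m hm ih =>
      have h1 := int_split univ MeasurableSet.univ m
      simp only [univ_inter] at h1
      rw [h1, ih]
      have h2 : P.real {ω | N ω = m} = p m - p (m + 1) := by linarith [p_split m]
      rw [h2, hc]
      rcases eq_or_ne (p m - p (m + 1)) 0 with h0 | hne
      · rw [h0, show p m = p (m + 1) by linarith]; simp
      · simp only
        rw [div_mul_cancel₀ _ hne]
        ring
  refine ⟨c, hint, fun m => ?_, fun A hA => by simpa using upper A hA 0 (by omega)⟩
  rcases le_or_gt m (K + 1) with hm | hm
  · exact exact_level m hm
  · have : {ω | m ≤ N ω} = ∅ := by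
      ext ω
      have := hNK ω
      simp only [mem_ofPred_eq, mem_empty_iff_false, iff_false]
      omega
    simp [this, hl0]

lemma sum_indicator_lt {N K : ℕ} (h : N ≤ K) (z : ℝ) :
    ∑ m ∈ Finset.range K, (if m + 1 ≤ N then z else 0) = N * z := by
  rw [← Finset.sum_filter, Finset.sum_const, nsmul_eq_mul]
  congr 2
  rw [show (Finset.range K).filter (fun m => m + 1 ≤ N) = Finset.range N by
    ext m; simp only [Finset.mem_filter, Finset.mem_range]; omega]
  simp

lemma integral_mul_eq_sum_levels (P : Measure Ω) {N : Ω → ℕ} (hN : Measurable N)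
    {K : ℕ} (hNK : ∀ ω, N ω ≤ K) {Z : Ω → ℝ} (hZ : Integrable Z P) :
    ∫ ω, N ω * Z ω ∂P = ∑ m ∈ Finset.range K, ∫ ω in {ω | m + 1 ≤ N ω}, Z ω ∂P := by
  have mge : ∀ m, MeasurableSet {ω | m ≤ N ω} := fun m => measurableSet_le measurable_const hN
  simp_rw [← integral_indicator (mge _)]
  rw [← integral_finsetSum _ fun m _ => hZ.indicator (mge _)]
  congr 1
  ext ω
  rw [← sum_indicator_lt (hNK ω)]
  simp [indicator_apply]

/-- The sup-convolution bound for integer-valued allocations. -/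
lemma sum_levels_le_sum_levels_sum (P : Measure Ω) [IsProbabilityMeasure P] {n : ℕ} (hn : 0 < n)
    {l : Fin n → ℝ → ℝ} (hl : ∀ i, ConcaveOn ℝ (Icc 0 1) (l i)) (hl0 : ∀ i, l i 0 = 0)
    {k : ℝ → ℝ} (hk : ∀ t : Fin n → ℝ, (∀ i, t i ∈ Icc (0:ℝ) 1) → ∑ i, t i ≤ 1 →
      ∑ i, l i (t i) ≤ k (∑ i, t i))
    {N : Fin n → Ω → ℕ} (hN : ∀ i, Measurable (N i)) {K : ℕ} (hNK : ∀ ω, ∑ i, N i ω ≤ K) :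
    ∑ i, ∑ m ∈ Finset.range K, l i (P.real {ω | m + 1 ≤ N i ω}) ≤
      ∑ m ∈ Finset.range K, k (P.real {ω | m + 1 ≤ ∑ i, N i ω}) := by
  have hNiK : ∀ i ω, N i ω ≤ K := fun i ω =>
    (Finset.single_le_sum (f := fun i => N i ω) (fun _ _ => Nat.zero_le _)
      (Finset.mem_univ i)).trans (hNK ω)
  choose c hint hlevel hdom using fun i =>
    exists_dominated_density P (hl i) (hl0 i) (hN i) (hNiK i)
  have hNsum : Measurable fun ω => ∑ i, N i ω := Finset.measurable_sum _ fun i _ => hN i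
  have : Nonempty (Fin n) := ⟨⟨0, hn⟩⟩
  have hcm : ∀ i, Measurable fun ω => c i (N i ω) := fun i => measurable_from_nat.comp (hN i)
  -- `first i` is the event that `i` is the first index at which the density is maximal
  set first : Fin n → Set Ω := fun i => {ω | (∀ j, c j (N j ω) ≤ c i (N i ω)) ∧
    ∀ j < i, c j (N j ω) < c i (N i ω)} with hfirst
  have first_meas : ∀ i, MeasurableSet (first i) := by
    intro i
    have : first i = (⋂ j, {ω | c j (N j ω) ≤ c i (N i ω)}) ∩
        ⋂ j, ⋂ (_ : j < i), {ω | c j (N j ω) < c i (N i ω)} := by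
      ext ω; simp [hfirst]
    rw [this]
    exact (MeasurableSet.iInter fun j => measurableSet_le (hcm j) (hcm i)).inter
      (MeasurableSet.iInter fun j => MeasurableSet.iInter fun _ =>
        measurableSet_lt (hcm j) (hcm i))
  have first_disj : Pairwise (Function.onFun Disjoint first) := by
    intro i j hij
    rw [Function.onFun, Set.disjoint_left]
    rintro ω ⟨hi, hi'⟩ ⟨hj, hj'⟩
    rcases lt_or_gt_of_ne hij with h | h
    · exact absurd (hi j) (not_le.2 (hj' i h))
    · exact absurd (hj i) (not_le.2 (hi' j h))
  have first_cover : ⋃ i, first i = univ := by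
    refine eq_univ_of_forall fun ω => mem_iUnion.2 ?_
    obtain ⟨i₀, -, hi₀⟩ := Finset.exists_max_image Finset.univ (fun i => c i (N i ω))
      Finset.univ_nonempty
    set S := Finset.univ.filter fun i => ∀ j, c j (N j ω) ≤ c i (N i ω) with hS
    have hSne : S.Nonempty := ⟨i₀, by simpa [hS] using hi₀⟩
    have hmin := S.min'_mem hSne
    refine ⟨S.min' hSne, by simpa [hS] using hmin, fun j hj => ?_⟩
    by_contra! hcon
    have hjS : j ∈ S := by
      simp only [hS, Finset.mem_filter, Finset.mem_univ, true_and] at hmin ⊢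
      exact fun j' => (hmin j').trans hcon
    exact absurd (S.min'_le j hjS) (not_le.2 hj)
  set Z : Ω → ℝ := fun ω => ∑ i, (first i).indicator (fun ω => c i (N i ω)) ω with hZ
  have hZint : Integrable Z P := integrable_finsetSum _ fun i _ => (hint i).indicator (first_meas i)
  have Z_eq : ∀ i, ∀ ω ∈ first i, Z ω = c i (N i ω) := by
    intro i ω hω
    simp only [hZ]
    rw [Finset.sum_eq_single i, indicator_of_mem hω]
    · intro j _ hji
      exact indicator_of_notMem (fun hj => (Set.disjoint_left.1 (first_disj hji)) hj hω) _
    · simp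
  have le_Z : ∀ i ω, c i (N i ω) ≤ Z ω := by
    intro i ω
    obtain ⟨j, hj⟩ := mem_iUnion.1 (first_cover ▸ mem_univ ω : ω ∈ ⋃ i, first i)
    rw [Z_eq j ω hj]
    exact hj.1 i
  have hmul : ∀ (M : Ω → ℕ) (W : Ω → ℝ), Measurable M → (∀ ω, M ω ≤ K) → Integrable W P →
      Integrable (fun ω => M ω * W ω) P := by
    intro M W hM hMK hW
    refine hW.bdd_mul (c := K) (measurable_from_nat.comp hM).aestronglyMeasurable
      (Filter.Eventually.of_forall fun ω => ?_)
    simpa using hMK ω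
  calc ∑ i, ∑ m ∈ Finset.range K, l i (P.real {ω | m + 1 ≤ N i ω})
      = ∑ i, ∫ ω, N i ω * c i (N i ω) ∂P := by
        refine Finset.sum_congr rfl fun i _ => ?_
        rw [integral_mul_eq_sum_levels P (hN i) (hNiK i) (hint i)]
        exact Finset.sum_congr rfl fun m _ => (hlevel i _).symm
    _ ≤ ∑ i, ∫ ω, N i ω * Z ω ∂P := by
        refine Finset.sum_le_sum fun i _ => integral_mono (hmul _ _ (hN i) (hNiK i) (hint i))
          (hmul _ _ (hN i) (hNiK i) hZint) fun ω => ?_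
        exact mul_le_mul_of_nonneg_left (le_Z i ω) (Nat.cast_nonneg _)
    _ = ∫ ω, (∑ i, N i ω : ℕ) * Z ω ∂P := by
        rw [← integral_finsetSum _ fun i _ => hmul _ _ (hN i) (hNiK i) hZint]
        congr 1
        ext ω
        rw [Nat.cast_sum, Finset.sum_mul]
    _ = ∑ m ∈ Finset.range K, ∫ ω in {ω | m + 1 ≤ ∑ i, N i ω}, Z ω ∂P :=
        integral_mul_eq_sum_levels P hNsum hNK hZint
    _ ≤ _ := by
        refine Finset.sum_le_sum fun m _ => ?_
        set B := {ω | m + 1 ≤ ∑ i, N i ω}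
        have mB : MeasurableSet B := measurableSet_le measurable_const hNsum
        have hBU : B = ⋃ i, B ∩ first i := by rw [← inter_iUnion, first_cover, inter_univ]
        have dB : Pairwise (Function.onFun Disjoint fun i => B ∩ first i) := fun i j hij =>
          (first_disj hij).mono inter_subset_right inter_subset_right
        have hPB : P.real B = ∑ i, P.real (B ∩ first i) := by
          conv_lhs => rw [hBU]
          exact measureReal_iUnion_fintype dB fun i => mB.inter (first_meas i)
        have hZB : ∫ ω in B, Z ω ∂P = ∑ i, ∫ ω in B ∩ first i, c i (N i ω) ∂P := by
          conv_lhs => rw [hBU]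
          rw [integral_iUnion_fintype (fun i => mB.inter (first_meas i)) dB
            fun i => hZint.integrableOn]
          refine Finset.sum_congr rfl fun i _ => ?_
          exact setIntegral_congr_fun (mB.inter (first_meas i)) fun ω hω => Z_eq i ω hω.2
        rw [hZB, hPB]
        refine (Finset.sum_le_sum fun i _ => hdom i _ (mB.inter (first_meas i))).trans ?_
        exact hk _ (fun i => measureReal_mem_Icc P _) (hPB ▸ measureReal_le_one)

lemma exists_partition_unitInterval {n : ℕ} {r : Fin n → ℝ} (hr : ∀ i, 0 ≤ r i)
    (hr1 : ∑ i, r i = 1) :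
    ∃ V : Fin n → Set ℝ, (∀ i, MeasurableSet (V i)) ∧ Pairwise (Function.onFun Disjoint V) ∧
      ⋃ i, V i = Ioc 0 1 ∧ ∀ i, volume.real (V i) = r i := by
  set R : ℕ → ℝ := fun k => ∑ j : Fin n with j.val < k, r j with hR
  have hRsucc : ∀ i : Fin n, R (i + 1) = R i + r i := by
    intro i
    have : (Finset.univ.filter fun j : Fin n => j.val < i.val + 1) =
        insert i (Finset.univ.filter fun j : Fin n => j.val < i.val) := by
      ext j
      simp only [Finset.mem_filter, Finset.mem_univ, true_and, Finset.mem_insert, Fin.ext_iff]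
      omega
    simp only [hR]
    rw [this, Finset.sum_insert (by simp)]
    ring
  have hmono : Monotone R := fun a b hab =>
    Finset.sum_le_sum_of_subset_of_nonneg
      (Finset.monotone_filter_right _ fun j _ hj => lt_of_lt_of_le hj hab) fun i _ _ => hr i
  have hR0 : R 0 = 0 := by simp [hR]
  have hRn : R n = 1 := by simp [hR, hr1]
  refine ⟨fun i => Ioc (R i) (R (i + 1)), fun i => measurableSet_Ioc, ?_, ?_, fun i => ?_⟩
  · intro i j hij
    exact hmono.pairwise_disjoint_on_Ioc_succ (Fin.val_ne_of_ne hij)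
  · have := hmono.biUnion_Ico_Ioc_map_succ 0 n
    rw [hR0, hRn] at this
    rw [← this]
    ext x
    simp only [mem_iUnion, mem_Ico, Nat.zero_le, true_and, exists_prop, Order.succ_eq_add_one]
    exact ⟨fun ⟨i, hi⟩ => ⟨i, i.2, hi⟩, fun ⟨i, hin, hi⟩ => ⟨⟨i, hin⟩, hi⟩⟩
  · rw [Real.volume_real_Ioc_of_le (hmono (Nat.le_succ _)), hRsucc]
    ring

/-- Randomized partition: conditionally on `J = m`, the `i`-th cell has probability `w m i`. -/
lemma exists_partition_of_indepFun (P : Measure Ω) [IsProbabilityMeasure P] {n : ℕ}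
    {U : Ω → ℝ} (hU : Measurable U) (hUunif : Measure.map U P = volume.restrict (Icc (0:ℝ) 1))
    {J : Ω → ℕ} (hJ : Measurable J) (hindep : IndepFun U J P) {w : ℕ → Fin n → ℝ}
    (hw : ∀ m i, 0 ≤ w m i) (hw1 : ∀ m, ∑ i, w m i = 1) :
    ∃ A : Fin n → Set Ω, (∀ i, MeasurableSet (A i)) ∧ Pairwise (Function.onFun Disjoint A) ∧
      (∀ᵐ ω ∂P, ∃ i, ω ∈ A i) ∧
      ∀ m i, P.real (A i ∩ {ω | J ω = m}) = w m i * P.real {ω | J ω = m} := by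
  choose V hVm hVd hVu hVv using fun m => exists_partition_unitInterval (hw m) (hw1 m)
  refine ⟨fun i => {ω | U ω ∈ V (J ω) i}, fun i => ?_, fun i j hij => ?_, ?_, fun m i => ?_⟩
  · have : {ω | U ω ∈ V (J ω) i} = ⋃ m, (J ⁻¹' {m} ∩ U ⁻¹' V m i) := by
      ext ω; simp
    beta_reduce
    rw [this]
    exact MeasurableSet.iUnion fun m => (hJ (measurableSet_singleton m)).inter (hU (hVm m i))
  · exact Set.disjoint_left.2 fun ω hi hj => Set.disjoint_left.1 (hVd (J ω) hij) hi hj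
  · have h0 : volume.restrict (Icc (0:ℝ) 1) (Ioc 0 1)ᶜ = 0 := by
      rw [← restrict_Ioc_eq_restrict_Icc, Measure.restrict_apply measurableSet_Ioc.compl]
      simp
    have h1 : ∀ᵐ ω ∂P, U ω ∈ Ioc (0:ℝ) 1 := by
      rw [← hUunif, Measure.map_apply hU measurableSet_Ioc.compl] at h0
      exact h0
    filter_upwards [h1] with ω hω
    rw [← hVu (J ω)] at hω
    exact mem_iUnion.1 hω
  · have hset : {ω | U ω ∈ V (J ω) i} ∩ {ω | J ω = m} = U ⁻¹' V m i ∩ J ⁻¹' {m} := by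
      ext ω
      simp only [mem_inter_iff, mem_ofPred_eq, mem_preimage, mem_singleton_iff]
      exact and_congr_left fun h => by rw [h]
    have hsub : V m i ⊆ Icc (0:ℝ) 1 :=
      (subset_iUnion (V m) i).trans ((hVu m).subset.trans Ioc_subset_Icc_self)
    rw [hset, measureReal_def, hindep.measure_inter_preimage_eq_mul _ _ (hVm m i)
      (measurableSet_singleton m), ENNReal.toReal_mul, ← Measure.map_apply hU (hVm m i), hUunif,
      Measure.restrict_apply (hVm m i), inter_eq_left.2 hsub, ← measureReal_def, hVv]
    rfl

/-- A partition whose cells split every upper level set of `J` optimally. -/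
lemma exists_partition_optimal (P : Measure Ω) [IsProbabilityMeasure P] {n : ℕ} (hn : 0 < n)
    {l : Fin n → ℝ → ℝ} (hcont : ∀ i, ContinuousOn (l i) (Icc 0 1))
    (hconc : ∀ i, ConcaveOn ℝ (Icc 0 1) (l i))
    {U : Ω → ℝ} (hU : Measurable U) (hUunif : Measure.map U P = volume.restrict (Icc (0:ℝ) 1))
    {J : Ω → ℕ} (hJ : Measurable J) {K : ℕ} (hJK : ∀ ω, J ω ≤ K) (hindep : IndepFun U J P) :
    ∃ A : Fin n → Set Ω, (∀ i, MeasurableSet (A i)) ∧ Pairwise (Function.onFun Disjoint A) ∧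
      (∀ᵐ ω ∂P, ∃ i, ω ∈ A i) ∧
      ∀ m ≤ K + 1, ∑ i, l i (P.real (A i ∩ {ω | m ≤ J ω})) =
        funSupConv l (P.real {ω | m ≤ J ω}) := by
  set q : ℕ → ℝ := fun m => P.real {ω | m ≤ J ω} with hq
  have hq_split : ∀ m, q m = q (m + 1) + P.real {ω | J ω = m} := fun m => by
    simpa only [univ_inter] using measureReal_inter_level P hJ MeasurableSet.univ m
  have hq01 : ∀ m, q m ∈ Icc (0:ℝ) 1 := fun m => measureReal_mem_Icc P _
  have hq_anti : ∀ m, q (m + 1) ≤ q m := fun m => by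
    rw [hq_split m]; linarith [measureReal_nonneg (μ := P) (s := {ω | J ω = m})]
  choose! next hnext hnext_le using fun (m : ℕ) (t : Fin n → ℝ) (ht : IsOptSplit l (q m) t) =>
    ht.exists_le hn hcont hconc (hq01 (m + 1)).1 (hq_anti m) (hq01 m).2
  obtain ⟨t₀, ht₀⟩ := exists_isOptSplit hn hcont (hq01 0)
  set t : ℕ → Fin n → ℝ := fun m => Nat.rec t₀ (fun m s => next m s) m
  have hopt : ∀ m, IsOptSplit l (q m) (t m) := by
    intro m
    induction m with
    | zero => exact ht₀
    | succ m ih => exact hnext m _ ih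
  have hanti : ∀ m i, t (m + 1) i ≤ t m i := fun m => hnext_le m _ (hopt m)
  set w : ℕ → Fin n → ℝ := fun m i => if q m = q (m + 1) then (if i = ⟨0, hn⟩ then 1 else 0)
    else (t m i - t (m + 1) i) / (q m - q (m + 1)) with hw
  have hw_nonneg : ∀ m i, 0 ≤ w m i := by
    intro m i
    simp only [hw]
    split_ifs
    · exact zero_le_one
    · exact le_rfl
    · exact div_nonneg (sub_nonneg.2 (hanti m i)) (sub_nonneg.2 (hq_anti m))
  have hw_sum : ∀ m, ∑ i, w m i = 1 := by
    intro m
    simp only [hw]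
    split_ifs with h
    · simp
    · rw [← Finset.sum_div, Finset.sum_sub_distrib, (hopt m).2.1, (hopt (m + 1)).2.1]
      exact div_self (sub_ne_zero.2 h)
  have hw_mul : ∀ m i, w m i * P.real {ω | J ω = m} = t m i - t (m + 1) i := by
    intro m i
    rw [show P.real {ω | J ω = m} = q m - q (m + 1) by linarith [hq_split m]]
    simp only [hw]
    split_ifs with h hi
    all_goals try
      rw [h, sub_self, mul_zero]
      have hsum : ∑ i, (t m i - t (m + 1) i) = 0 := by
        rw [Finset.sum_sub_distrib, (hopt m).2.1, (hopt (m + 1)).2.1, h, sub_self]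
      exact ((Finset.sum_eq_zero_iff_of_nonneg fun i _ => sub_nonneg.2 (hanti m i)).1 hsum i
        (Finset.mem_univ i)).symm
    exact div_mul_cancel₀ _ (sub_ne_zero.2 h)
  obtain ⟨A, hAm, hAd, hAc, hAw⟩ :=
    exists_partition_of_indepFun P hU hUunif hJ hindep hw_nonneg hw_sum
  refine ⟨A, hAm, hAd, hAc, fun m hm => ?_⟩
  have hempty : {ω | K + 1 ≤ J ω} = ∅ := by
    ext ω
    simpa using hJK ω
  have key : ∀ i, P.real (A i ∩ {ω | m ≤ J ω}) = t m i := by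
    intro i
    induction hm using Nat.decreasingInduction with
    | self =>
      have hsum : ∑ i, t (K + 1) i = 0 := by
        rw [(hopt (K + 1)).2.1]
        simp only [hq]
        rw [hempty]
        simp
      rw [hempty, (Finset.sum_eq_zero_iff_of_nonneg fun i _ => ((hopt (K + 1)).1 i).1).1 hsum i
        (Finset.mem_univ i)]
      simp
    | of_succ m hm ih =>
      rw [measureReal_inter_level P hJ (hAm i), ih, hAw, hw_mul]
      ring
  simp only [key]
  exact (hopt m).funSupConv_eq.symm

lemma counterMonotone_indicator (P : Measure Ω) {X : Ω → ℝ} (hX : ∀ ω, X ω ≤ 0) {A B : Set Ω}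
    (hAB : Disjoint A B) : CounterMonotone P (A.indicator X) (B.indicator X) := by
  refine Filter.Eventually.of_forall fun p => ?_
  have hprod : ∀ ω, A.indicator X ω * B.indicator X ω = 0 := by
    intro ω
    by_cases hA : ω ∈ A
    · simp [Set.disjoint_left.1 hAB hA]
    · simp [hA]
  have hnonpos : ∀ (C : Set Ω) ω, C.indicator X ω ≤ 0 := fun C ω =>
    indicator_apply_nonpos fun _ => hX ω
  have h1 := mul_nonneg_of_nonpos_of_nonpos (hnonpos A p.1) (hnonpos B p.2)
  have h2 := mul_nonneg_of_nonpos_of_nonpos (hnonpos A p.2) (hnonpos B p.1)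
  nlinarith [hprod p.1, hprod p.2]

lemma exists_counterMonotone_alloc (P : Measure Ω) [IsProbabilityMeasure P] {n : ℕ} (hn : 0 < n)
    {l : Fin n → ℝ → ℝ} (hmono : ∀ i, MonotoneOn (l i) (Icc 0 1)) (hl0 : ∀ i, l i 0 = 0)
    (hcont : ∀ i, ContinuousOn (l i) (Icc 0 1)) (hconc : ∀ i, ConcaveOn ℝ (Icc 0 1) (l i))
    (hkmono : MonotoneOn (funSupConv l) (Icc 0 1)) (hk0 : funSupConv l 0 = 0)
    {X : Ω → ℝ} (hX : MemLneg X) {U : Ω → ℝ} (hU : Measurable U)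
    (hUunif : Measure.map U P = volume.restrict (Icc (0:ℝ) 1)) (hindep : IndepFun U X P)
    {ε : ℝ} (hε : 0 < ε) :
    ∃ Xs : Fin n → Ω → ℝ, IsAllocNeg P X Xs ∧ PairwiseCtr P Xs ∧
      tailIntegral P (funSupConv l) (fun ω => -X ω) ≤
        ε * funSupConv l 1 + ∑ i, tailIntegral P (l i) (fun ω => -Xs i ω) := by
  obtain ⟨hXm, hX0, M, hM⟩ := hX
  obtain ⟨K, hK⟩ := exists_nat_ge (M / ε)
  have hXK : ∀ ω, -X ω ≤ ε * K := fun ω => by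
    have := (div_le_iff₀' hε).1 hK
    linarith [hM ω]
  have hf : Measurable fun x : ℝ => ⌈-x / ε⌉₊ := Nat.measurable_ceil.comp (by fun_prop)
  obtain ⟨A, hAm, hAd, hAc, hAopt⟩ := exists_partition_optimal P hn hcont hconc hU hUunif
    (J := fun ω => ⌈-X ω / ε⌉₊) (K := K) (hf.comp hXm)
    (fun ω => Nat.ceil_le.2 ((div_le_iff₀' hε).2 (hXK ω))) (hindep.comp measurable_id hf)
  have hlevel : ∀ m : ℕ, {ω | ε * (m + 1 : ℕ) < -X ω} = {ω | m + 2 ≤ ⌈-X ω / ε⌉₊} := by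
    intro m
    ext ω
    simp only [mem_ofPred_eq]
    rw [← lt_div_iff₀' hε, ← Nat.lt_ceil, Nat.lt_iff_add_one_le]
  have hlevel' : ∀ i (m : ℕ), {ω | ε * (m + 1 : ℕ) < -(A i).indicator X ω} =
      A i ∩ {ω | m + 2 ≤ ⌈-X ω / ε⌉₊} := by
    intro i m
    rw [← hlevel]
    ext ω
    by_cases h : ω ∈ A i
    · simp [h]
    · simp only [mem_ofPred_eq, mem_inter_iff, h, false_and, iff_false, not_lt,
        indicator_of_notMem, not_false_eq_true, neg_zero]
      positivity
  refine ⟨fun i => (A i).indicator X, ⟨fun i => ⟨hXm.indicator (hAm i), fun ω =>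
    indicator_apply_nonpos fun _ => hX0 ω, M, fun ω => ?_⟩, ?_⟩, fun i j hij =>
    counterMonotone_indicator P hX0 (hAd hij), ?_⟩
  · by_cases h : ω ∈ A i
    · simpa [h] using hM ω
    · simpa [h] using (neg_le.1 ((hM ω).trans (hX0 ω)))
  · filter_upwards [hAc] with ω ⟨i, hi⟩
    rw [Finset.sum_eq_single i, indicator_of_mem hi]
    · intro j _ hji
      exact indicator_of_notMem (fun hj => Set.disjoint_left.1 (hAd hji) hj hi) _
    · simp
  · refine (tailIntegral_le P hkmono hk0 hε hXK).trans (add_le_add_right ?_ _)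
    have hsum : ∑ i, ε * ∑ m ∈ Finset.range K,
        l i (P.real {ω | ε * (m + 1 : ℕ) < -(A i).indicator X ω}) ≤
        ∑ i, tailIntegral P (l i) (fun ω => -(A i).indicator X ω) := by
      refine Finset.sum_le_sum fun i _ => le_tailIntegral P (hmono i) (hl0 i) hε fun ω => ?_
      by_cases h : ω ∈ A i
      · simpa [h] using hXK ω
      · simp only [h, not_false_eq_true, indicator_of_notMem, neg_zero]
        positivity
    refine le_trans (le_of_eq ?_) hsum
    rw [← Finset.mul_sum, Finset.sum_comm]
    congr 1
    refine Finset.sum_congr rfl fun m hm => ?_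
    have hm' := Finset.mem_range.1 hm
    simp only [hlevel', hlevel]
    exact (hAopt (m + 2) (by omega)).symm

lemma sum_tailIntegral_le (P : Measure Ω) [IsProbabilityMeasure P] {n : ℕ} (hn : 0 < n)
    {l : Fin n → ℝ → ℝ} (hmono : ∀ i, MonotoneOn (l i) (Icc 0 1)) (hl0 : ∀ i, l i 0 = 0)
    (hconc : ∀ i, ConcaveOn ℝ (Icc 0 1) (l i))
    {k : ℝ → ℝ} (hkmono : MonotoneOn k (Icc 0 1)) (hk0 : k 0 = 0)
    (hk : ∀ t : Fin n → ℝ, (∀ i, t i ∈ Icc (0:ℝ) 1) → ∑ i, t i ≤ 1 →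
      ∑ i, l i (t i) ≤ k (∑ i, t i))
    {X : Ω → ℝ} (hX : MemLneg X) {Xs : Fin n → Ω → ℝ} (hXs : IsAllocNeg P X Xs) :
    ∑ i, tailIntegral P (l i) (fun ω => -Xs i ω) ≤ tailIntegral P k (fun ω => -X ω) := by
  obtain ⟨hXm, hX0, M, hM⟩ := hX
  obtain ⟨hXsneg, hXsum⟩ := hXs
  choose hXsm hXs0 B hB using hXsneg
  have hΩ : Nonempty Ω := nonempty_of_isProbabilityMeasure P
  obtain ⟨ω₀⟩ := hΩ
  have hB0 : ∀ i, 0 ≤ B i := fun i => by linarith [hB i ω₀, hXs0 i ω₀]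
  have hM0 : 0 ≤ M := by linarith [hM ω₀, hX0 ω₀]
  suffices hsuff : ∀ ε > 0, ∑ i, tailIntegral P (l i) (fun ω => -Xs i ω) ≤
      tailIntegral P k (fun ω => -X ω) + ε * ∑ i, l i 1 by
    have hnonneg : 0 ≤ ∑ i, l i 1 := Finset.sum_nonneg fun i _ =>
      hl0 i ▸ hmono i (by simp) (by simp) zero_le_one
    refine le_of_forall_pos_le_add fun δ hδ => ?_
    have h1 := hsuff (δ / (∑ i, l i 1 + 1)) (by positivity)
    have h2 : δ / (∑ i, l i 1 + 1) * ∑ i, l i 1 ≤ δ := by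
      rw [div_mul_eq_mul_div, div_le_iff₀ (by positivity)]
      nlinarith
    linarith
  intro ε hε
  obtain ⟨K, hK⟩ := exists_nat_ge ((∑ i, B i + M) / ε)
  rw [div_le_iff₀' hε] at hK
  have hXK : ∀ ω, -X ω ≤ ε * K := fun ω => by
    linarith [hM ω, Finset.sum_nonneg fun i (_ : i ∈ Finset.univ) => hB0 i]
  have hXsK : ∀ i ω, -Xs i ω ≤ ε * K := fun i ω => by
    linarith [hB i ω, Finset.single_le_sum (fun i _ => hB0 i) (Finset.mem_univ i)]
  set N : Fin n → Ω → ℕ := fun i ω => ⌈-Xs i ω / ε⌉₊ - 1 with hN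
  have hNm : ∀ i, Measurable (N i) := fun i =>
    (measurable_from_nat (f := fun m => m - 1)).comp
      (Nat.measurable_ceil.comp ((hXsm i).neg.div_const ε))
  have hN_le : ∀ i ω, ε * N i ω ≤ -Xs i ω := by
    intro i ω
    rcases Nat.eq_zero_or_pos (N i ω) with h0 | hpos
    · rw [h0]; simpa using hXs0 i ω
    · have : N i ω < ⌈-Xs i ω / ε⌉₊ := by simp only [hN] at hpos ⊢; omega
      rw [Nat.lt_ceil, lt_div_iff₀' hε] at this
      exact this.le
  have hlevel : ∀ i (m : ℕ), {ω | ε * (m + 1 : ℕ) < -Xs i ω} = {ω | m + 1 ≤ N i ω} := by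
    intro i m
    ext ω
    simp only [mem_ofPred_eq, hN]
    rw [← lt_div_iff₀' hε, ← Nat.lt_ceil]
    omega
  have hNK : ∀ ω, ∑ i, N i ω ≤ K := by
    intro ω
    have h1 : ε * ((∑ i, N i ω : ℕ) : ℝ) ≤ ε * K := by
      rw [Nat.cast_sum, Finset.mul_sum]
      calc ∑ i, ε * (N i ω : ℝ) ≤ ∑ i, B i :=
            Finset.sum_le_sum fun i _ => (hN_le i ω).trans (by linarith [hB i ω])
        _ ≤ ε * K := by linarith
    exact_mod_cast le_of_mul_le_mul_left h1 hε
  have hlevel_sum : ∀ m : ℕ, P.real {ω | m + 1 ≤ ∑ i, N i ω} ≤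
      P.real {ω | ε * (m + 1 : ℕ) < -X ω} := by
    intro m
    refine ENNReal.toReal_mono (measure_ne_top _ _) (measure_mono_ae ?_)
    filter_upwards [hXsum] with ω hω hm
    change m + 1 ≤ ∑ i, N i ω at hm
    change ε * (m + 1 : ℕ) < -X ω
    obtain ⟨j, -, hj⟩ : ∃ j ∈ Finset.univ, N j ω ≠ 0 := by
      by_contra! h
      rw [Finset.sum_eq_zero h] at hm
      omega
    have hstrict : ε * N j ω < -Xs j ω := by
      have : N j ω < ⌈-Xs j ω / ε⌉₊ := by simp only [hN] at hj ⊢; omega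
      rwa [Nat.lt_ceil, lt_div_iff₀' hε] at this
    calc ε * (m + 1 : ℕ) ≤ ε * ((∑ i, N i ω : ℕ) : ℝ) := by gcongr
      _ = ∑ i, ε * (N i ω : ℝ) := by rw [Nat.cast_sum, Finset.mul_sum]
      _ < ∑ i, -Xs i ω := Finset.sum_lt_sum (fun i _ => hN_le i ω) ⟨j, Finset.mem_univ j, hstrict⟩
      _ = -X ω := by rw [Finset.sum_neg_distrib, hω]
  calc ∑ i, tailIntegral P (l i) (fun ω => -Xs i ω)
      ≤ ∑ i, (ε * l i 1 + ε * ∑ m ∈ Finset.range K,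
          l i (P.real {ω | ε * (m + 1 : ℕ) < -Xs i ω})) :=
        Finset.sum_le_sum fun i _ => tailIntegral_le P (hmono i) (hl0 i) hε (hXsK i)
    _ = ε * ∑ i, ∑ m ∈ Finset.range K, l i (P.real {ω | m + 1 ≤ N i ω}) + ε * ∑ i, l i 1 := by
        simp only [hlevel]
        rw [Finset.sum_add_distrib, ← Finset.mul_sum, ← Finset.mul_sum, add_comm]
    _ ≤ ε * ∑ m ∈ Finset.range K, k (P.real {ω | ε * (m + 1 : ℕ) < -X ω}) + ε * ∑ i, l i 1 := by
        gcongr ε * ?_ + _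
        refine (sum_levels_le_sum_levels_sum P hn hconc hl0 hk hNm hNK).trans ?_
        exact Finset.sum_le_sum fun m _ =>
          hkmono (measureReal_mem_Icc P _) (measureReal_mem_Icc P _) (hlevel_sum m)
    _ ≤ tailIntegral P k (fun ω => -X ω) + ε * ∑ i, l i 1 := by
        gcongr
        exact le_tailIntegral P hkmono hk0 hε hXK

lemma monotoneOn_funSupConv {n : ℕ} (hn : 0 < n) {l : Fin n → ℝ → ℝ}
    (hmono : ∀ i, MonotoneOn (l i) (Icc 0 1)) (hcont : ∀ i, ContinuousOn (l i) (Icc 0 1))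
    (hconc : ∀ i, ConcaveOn ℝ (Icc 0 1) (l i)) : MonotoneOn (funSupConv l) (Icc 0 1) := by
  intro y hy x hx hyx
  obtain ⟨t, ht⟩ := exists_isOptSplit hn hcont hx
  obtain ⟨s, hs, hst⟩ := ht.exists_le hn hcont hconc hy.1 hyx hx.2
  rw [hs.funSupConv_eq, ht.funSupConv_eq]
  exact Finset.sum_le_sum fun i _ => hmono i (hs.1 i) (ht.1 i) (hst i)

lemma funSupConv_zero {n : ℕ} (hn : 0 < n) {l : Fin n → ℝ → ℝ} (hl0 : ∀ i, l i 0 = 0)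
    (hcont : ∀ i, ContinuousOn (l i) (Icc 0 1)) : funSupConv l 0 = 0 := by
  obtain ⟨t, ht⟩ := exists_isOptSplit hn hcont (x := 0) (by simp)
  have h0 := (Finset.sum_eq_zero_iff_of_nonneg fun i _ => (ht.1 i).1).1 ht.2.1
  rw [ht.funSupConv_eq]
  exact Finset.sum_eq_zero fun i hi => by rw [h0 i hi, hl0]

lemma sum_le_funSupConv {n : ℕ} (hn : 0 < n) {l : Fin n → ℝ → ℝ}
    (hcont : ∀ i, ContinuousOn (l i) (Icc 0 1)) (t : Fin n → ℝ) (ht : ∀ i, t i ∈ Icc (0:ℝ) 1)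
    (ht1 : ∑ i, t i ≤ 1) : ∑ i, l i (t i) ≤ funSupConv l (∑ i, t i) := by
  obtain ⟨s, hs⟩ := exists_isOptSplit hn hcont
    (x := ∑ i, t i) ⟨Finset.sum_nonneg fun i _ => (ht i).1, ht1⟩
  rw [hs.funSupConv_eq]
  exact hs.2.2 t ht rfl

/-- Theorem 2 on `L^−`. If each `h_i ∈ H` is continuous and convex on
`[0,1]`, `X ∈ L^−`, and there is a uniform random variable on `[0,1]` independent of `X`,
then `□ ρ_{h_i}(X) = ⊟ ρ_{h_i}(X) = ρ_g(X)` where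
`g(x) = (◊ h̃_i)(1) − (◊ h̃_i)(1−x)` with `h̃_i(t) = 1 − h_i(1−t)`. -/
theorem infConv_convex_Lminus
    (P : Measure Ω) [IsProbabilityMeasure P] (hP : Atomless P)
    {n : ℕ} (hn : 0 < n)
    (h : Fin n → ℝ → ℝ) (hH : ∀ i, MemH (h i))
    (hcont : ∀ i, ContinuousOn (h i) (Icc 0 1))
    (hconv : ∀ i, ConvexOn ℝ (Icc 0 1) (h i))
    (X : Ω → ℝ) (hX : MemLneg X)
    (U : Ω → ℝ) (hU : Measurable U)
    (hUunif : Measure.map U P = volume.restrict (Icc (0:ℝ) 1))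
    (hindep : IndepFun U X P)
    (g : ℝ → ℝ)
    (hg : ∀ x, g x = funSupConv (fun i t => 1 - h i (1 - t)) 1 -
      funSupConv (fun i t => 1 - h i (1 - t)) (1 - x)) :
    infConvNeg P h X = ctrInfConvNeg P h X ∧
    ctrInfConvNeg P h X = ((distortionNeg P g X : ℝ) : EReal) := by
  set l : Fin n → ℝ → ℝ := fun i t => 1 - h i (1 - t) with hl
  have hflip : ∀ t ∈ Icc (0:ℝ) 1, 1 - t ∈ Icc (0:ℝ) 1 := fun t ht =>
    ⟨by linarith [ht.2], by linarith [ht.1]⟩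
  have hl0 : ∀ i, l i 0 = 0 := fun i => by simp [hl, (hH i).2.2]
  have hlmono : ∀ i, MonotoneOn (l i) (Icc 0 1) := fun i x hx y hy hxy =>
    sub_le_sub_left ((hH i).1 (hflip y hy) (hflip x hx) (by linarith)) 1
  have hlcont : ∀ i, ContinuousOn (l i) (Icc 0 1) := fun i =>
    continuousOn_const.sub ((hcont i).comp (by fun_prop) hflip)
  have hlconc : ∀ i, ConcaveOn ℝ (Icc 0 1) (l i) := fun i => by
    refine ⟨convex_Icc 0 1, fun x hx y hy a b ha hb hab => ?_⟩
    have := (hconv i).2 (hflip x hx) (hflip y hy) ha hb hab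
    simp only [smul_eq_mul, hl] at this ⊢
    rw [show a * (1 - x) + b * (1 - y) = 1 - (a * x + b * y) by linear_combination hab] at this
    linear_combination this + hab
  have hkmono := monotoneOn_funSupConv hn hlmono hlcont hlconc
  have hk0 := funSupConv_zero hn hl0 hlcont
  have hρ : ∀ i {Y : Ω → ℝ}, Measurable Y →
      distortionNeg P (h i) Y = -tailIntegral P (l i) (fun ω => -Y ω) := fun i Y hY =>
    distortionNeg_eq_neg_tailIntegral P (fun p _ => by simp [hl, (hH i).2.2]) hY
  have hρg : distortionNeg P g X = -tailIntegral P (funSupConv l) (fun ω => -X ω) :=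
    distortionNeg_eq_neg_tailIntegral P (fun p _ => by
      rw [hg, hg, sub_sub_cancel, sub_self, hk0]; ring) hX.1
  have hlower : ((distortionNeg P g X : ℝ) : EReal) ≤ infConvNeg P h X := by
    refine le_sInf ?_
    rintro y ⟨Xs, hXs, rfl⟩
    rw [EReal.coe_le_coe_iff, hρg, Finset.sum_congr rfl fun i _ => hρ i (hXs.1 i).1,
      Finset.sum_neg_distrib, neg_le_neg_iff]
    exact sum_tailIntegral_le P hn hlmono hl0 hlconc hkmono hk0
      (sum_le_funSupConv hn hlcont) hX hXs
  have hmid : infConvNeg P h X ≤ ctrInfConvNeg P h X :=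
    sInf_le_sInf fun y ⟨Xs, hXs, _, hy⟩ => ⟨Xs, hXs, hy⟩
  have hupper : ctrInfConvNeg P h X ≤ ((distortionNeg P g X : ℝ) : EReal) := by
    refine EReal.le_of_forall_lt_iff_le.1 fun z hz => ?_
    rw [EReal.coe_lt_coe_iff] at hz
    have hk1 : 0 ≤ funSupConv l 1 := hk0 ▸ hkmono (by simp) (by simp) zero_le_one
    set δ := z - distortionNeg P g X with hδ
    have hδ0 : 0 < δ := sub_pos.2 hz
    obtain ⟨Xs, hXs, hctr, hle⟩ := exists_counterMonotone_alloc P hn hlmono hl0 hlcont hlconc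
      hkmono hk0 hX hU hUunif hindep (ε := δ / (funSupConv l 1 + 1)) (by positivity)
    unfold ctrInfConvNeg
    refine sInf_le_of_le ⟨Xs, hXs, hctr, rfl⟩ ?_
    rw [EReal.coe_le_coe_iff, Finset.sum_congr rfl fun i _ => hρ i (hXs.1 i).1,
      Finset.sum_neg_distrib]
    have : δ / (funSupConv l 1 + 1) * funSupConv l 1 ≤ δ := by
      rw [div_mul_eq_mul_div, div_le_iff₀ (by positivity)]
      nlinarith
    linarith
  exact ⟨le_antisymm hmid (hupper.trans hlower), le_antisymm hupper (hlower.trans hmid)⟩
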